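/- arXiv:1610.09774 — 2 statements merged into one kernel-verified Lean document; each statement's English description precedes it below -/
import Mathlib

section
/- Let s ≥ 1, n ≥ 1, μ ≥ 1 be integers. If there exists a sequence over an alphabet of n symbols in which every symbol occurs exactly μ times and which avoids alternations of length s+2, then there exists a sequence over an alphabet of n² symbols in which every symbol occurs exactly 2μ times and which avoids alternations of length max{3, s+1} + 2. -/
/-- The alternating sequence `a, b, a, b, ...` of length `k`. -/
def altSeq {α : Type*} (a b : α) : ℕ → List α
  | 0 => []
  | k + 1 => a :: altSeq b a k

/-- `l` avoids alternations of length `k`: it has no (not necessarily contiguous)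
subsequence `a, b, a, b, ...` of length `k` with `a ≠ b`. -/
def AvoidsAlt {α : Type*} (l : List α) (k : ℕ) : Prop :=
  ∀ a b : α, a ≠ b → ¬ (altSeq a b k).Sublist l

/-- `l` is an order-`s` Davenport–Schinzel sequence over an alphabet of `n` symbols:
no two consecutive entries are equal and it avoids alternations of length `s + 2`. -/
def IsDS (s n : ℕ) (l : List (Fin n)) : Prop :=
  l.Chain' (· ≠ ·) ∧ AvoidsAlt l (s + 2)

/-- `lambdaDS s n` is the maximum length of an order-`s` Davenport–Schinzel
sequence over an alphabet of `n` symbols. -/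
noncomputable def lambdaDS (s n : ℕ) : ℕ :=
  sSup { L | ∃ l : List (Fin n), IsDS s n l ∧ l.length = L }

section altSeq

variable {α β : Type*}

theorem map_altSeq (f : α → β) (a b : α) (k : ℕ) :
    (altSeq a b k).map f = altSeq (f a) (f b) k := by
  induction k generalizing a b with
  | zero => rfl
  | succ k ih => simp [altSeq, ih]

theorem mem_altSeq {a b x : α} {k : ℕ} (h : x ∈ altSeq a b k) : x = a ∨ x = b := by
  induction k generalizing a b with
  | zero => simp [altSeq] at h
  | succ k ih =>
    rcases List.mem_cons.1 h with h | h
    · exact Or.inl h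
    · exact (ih h).symm

theorem altSeq_isPrefix_of_le (a b : α) {m k : ℕ} (h : m ≤ k) : altSeq a b m <+: altSeq a b k := by
  induction m generalizing a b k with
  | zero => simp [altSeq]
  | succ m ih =>
    obtain ⟨k, rfl⟩ : ∃ k', k = k' + 1 := ⟨k - 1, by omega⟩
    exact (List.prefix_cons_inj a).2 (ih b a (by omega))

theorem altSeq_succ_eq_append (a b : α) (k : ℕ) :
    altSeq a b (k + 1) = altSeq a b k ++ [if Even k then a else b] := by
  induction k generalizing a b with
  | zero => simp [altSeq]
  | succ k ih =>
    rw [altSeq, ih b a]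
    by_cases hk : Even k <;> simp [altSeq, hk, Nat.even_add_one]

theorem reverse_altSeq (a b : α) (k : ℕ) :
    (altSeq a b k).reverse = if Even k then altSeq b a k else altSeq a b k := by
  induction k generalizing a b with
  | zero => simp [altSeq]
  | succ k ih =>
    rw [altSeq, List.reverse_cons, ih b a, altSeq_succ_eq_append b a k,
      ← altSeq.eq_2 a b k, altSeq_succ_eq_append a b k]
    by_cases hk : Even k <;> simp [hk, Nat.even_add_one]

theorem reverse_altSeq_eq_or (a b : α) (k : ℕ) :
    (altSeq a b k).reverse = altSeq a b k ∨ (altSeq a b k).reverse = altSeq b a k := by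
  rw [reverse_altSeq]
  split_ifs <;> simp

theorem AvoidsAlt.mono {l : List α} {m k : ℕ} (h : AvoidsAlt l m) (hmk : m ≤ k) :
    AvoidsAlt l k :=
  fun a b hab hs => h a b hab ((altSeq_isPrefix_of_le a b hmk).sublist.trans hs)

theorem AvoidsAlt.reverse {l : List α} {k : ℕ} (h : AvoidsAlt l k) : AvoidsAlt l.reverse k := by
  intro a b hab hs
  have hs' : (altSeq a b k).reverse.Sublist l := by simpa using hs.reverse
  rcases reverse_altSeq_eq_or a b k with e | e <;> rw [e] at hs'
  · exact h a b hab hs'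
  · exact h b a hab.symm hs'

theorem AvoidsAlt.map {l : List α} {k : ℕ} (h : AvoidsAlt l k) (e : α ≃ β) :
    AvoidsAlt (l.map e) k := by
  intro a b hab hs
  refine h (e.symm a) (e.symm b) (e.symm.injective.ne hab) ?_
  simpa [map_altSeq] using hs.map e.symm

/-- An alternation in `X ++ Y` loses at most one letter when restricted to `Y`, provided that `a`
never follows `b` in `X` and alternations in `Y` starting with `a` can be extended by `b`. -/
theorem altSeq_sublist_of_sublist_append {X Y : List α} {a b : α} {k : ℕ} (hk : 2 ≤ k)
    (hX : ¬ [b, a].Sublist X)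
    (hY : ∀ m, (altSeq a b (m + 1)).Sublist Y → (altSeq b a (m + 2)).Sublist Y)
    (h : (altSeq a b (k + 1)).Sublist (X ++ Y) ∨ (altSeq b a (k + 1)).Sublist (X ++ Y)) :
    (altSeq a b k).Sublist Y ∨ (altSeq b a k).Sublist Y := by
  obtain ⟨k, rfl⟩ : ∃ k', k = k' + 2 := ⟨k - 2, by omega⟩
  rcases h with h | h
  all_goals
    obtain ⟨u, v, huv, hu, hv⟩ := List.sublist_append_iff.1 h
    simp only [altSeq] at huv
  · rcases u with _ | ⟨x, _ | ⟨y, _ | ⟨z, u⟩⟩⟩ <;> simp only [List.nil_append, List.cons_append,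
      List.cons.injEq] at huv
    · subst huv
      exact Or.inr ((List.sublist_cons_self _ _).trans hv)
    · obtain ⟨rfl, rfl⟩ := huv
      exact Or.inr hv
    · obtain ⟨rfl, rfl, rfl⟩ := huv
      exact Or.inr (hY k hv)
    · obtain ⟨rfl, rfl, rfl, -⟩ := huv
      refine absurd (List.Sublist.trans ?_ hu) hX
      exact List.Sublist.cons _ (by simp)
  · rcases u with _ | ⟨x, _ | ⟨y, u⟩⟩ <;> simp only [List.nil_append, List.cons_append,
      List.cons.injEq] at huv
    · subst huv
      exact Or.inl ((List.sublist_cons_self _ _).trans hv)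
    · obtain ⟨rfl, rfl⟩ := huv
      exact Or.inl hv
    · obtain ⟨rfl, rfl, -⟩ := huv
      exact absurd (List.Sublist.trans (by simp) hu) hX

/-- If neither part contains an alternation of length three, the concatenation contains none of
length five. -/
theorem not_altSeq_five_sublist_append {X Y : List α} {a b : α}
    (hX : ¬ [a, b, a].Sublist X) (hYa : ¬ [a, b, a].Sublist Y) (hYb : ¬ [b, a, b].Sublist Y) :
    ¬ (altSeq a b 5).Sublist (X ++ Y) := by
  intro h
  obtain ⟨u, v, huv, hu, hv⟩ := List.sublist_append_iff.1 h
  simp only [altSeq] at huv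
  rcases u with _ | ⟨x, _ | ⟨y, _ | ⟨z, u⟩⟩⟩ <;> simp only [List.nil_append, List.cons_append,
      List.cons.injEq] at huv
  · subst huv
    exact hYa (List.Sublist.trans (by simp) hv)
  · obtain ⟨rfl, rfl⟩ := huv
    exact hYb (List.Sublist.trans (by simp) hv)
  · obtain ⟨rfl, rfl, rfl⟩ := huv
    exact hYa hv
  · obtain ⟨rfl, rfl, rfl, -⟩ := huv
    exact hX (List.Sublist.trans (by simp) hu)

end altSeq

section Grid

variable {α : Type*} [DecidableEq α]

/-- A symbol whose last occurrence is later can be appended to any subsequence. -/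
theorem append_sublist_of_idxOf_dedup_lt {l u : List α} {j k : α} (hk : k ∈ l)
    (hjk : l.dedup.idxOf j < l.dedup.idxOf k) (h : (u ++ [j]).Sublist l) :
    (u ++ [j, k]).Sublist l := by
  have hne : j ≠ k := by rintro rfl; exact lt_irrefl _ hjk
  obtain ⟨r, t, hrt, hkr⟩ := List.eq_append_cons_of_mem (List.mem_reverse.2 hk)
  obtain ⟨l₁, l₂, rfl, hk₂⟩ : ∃ l₁ l₂, l = l₁ ++ k :: l₂ ∧ k ∉ l₂ :=
    ⟨t.reverse, r.reverse, by simpa using congrArg List.reverse hrt, by simpa using hkr⟩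
  have hj₂ : j ∉ l₂ := by
    intro hj
    obtain ⟨q, hq⟩ : ∃ q, (l₁ ++ k :: l₂).dedup = q ++ k :: l₂.dedup := by
      rw [List.dedup_append, List.dedup_cons_of_notMem hk₂]
      obtain ⟨q, hq⟩ := List.suffix_union_right l₁ (k :: l₂.dedup)
      exact ⟨q, hq.symm⟩
    have hnd := List.nodup_dedup (l₁ ++ k :: l₂)
    rw [hq] at hnd hjk
    have hd := List.disjoint_of_nodup_append hnd
    have hkq : k ∉ q := fun h => hd h (by simp)
    have hjq : j ∉ q := fun h => hd h (by simp [hj])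
    rw [List.idxOf_append_of_notMem hkq, List.idxOf_append_of_notMem hjq] at hjk
    simp at hjk
  obtain ⟨v, w, hvw, hv, hw⟩ := List.sublist_append_iff.1 h
  have hw0 : w = [] := by
    rcases List.eq_nil_or_concat w with hw0 | ⟨w', x, rfl⟩
    · exact hw0
    · have hx : j = x := by
        rw [List.concat_eq_append, ← List.append_assoc] at hvw
        simpa using (List.append_inj' hvw rfl).2
      have : j ∈ k :: l₂ := hw.subset (by simp [hx])
      simp [hne, hj₂] at this
  subst hw0
  rw [List.append_nil] at hvw
  have : u ++ [j, k] = (u ++ [j]) ++ [k] := by simp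
  rw [this, hvw]
  exact hv.append (by simp)

/-- The copies `(i, l)` of `l`, concatenated in the order of last occurrence of `i` in `l`. -/
def rowCopies (l : List α) : List (α × α) := l.dedup.flatMap fun i => l.map (Prod.mk i)

/-- Copies of `l` along the columns of the grid, then reversed copies along the rows. -/
def gridSeq (l : List α) : List (α × α) := (rowCopies l).map Prod.swap ++ (rowCopies l).reverse

theorem filter_rowCopies {l : List α} {i : α} (hi : i ∈ l) :
    (rowCopies l).filter (fun x => x.1 = i) = l.map (Prod.mk i) := by
  have key : ∀ p : List α, p.Nodup → (p.flatMap fun i => l.map (Prod.mk i)).filter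
      (fun x => x.1 = i) = if i ∈ p then l.map (Prod.mk i) else [] := by
    intro p hp
    induction p with
    | nil => simp
    | cons x p ih =>
      obtain ⟨hx, hp⟩ := List.nodup_cons.1 hp
      rw [List.flatMap_cons, List.filter_append, ih hp, List.filter_map]
      by_cases hxi : x = i
      · subst hxi
        simp [hx, Function.comp_def]
      · simp [hxi, Ne.symm hxi, Function.comp_def]
  rw [rowCopies, key _ l.nodup_dedup, if_pos (List.mem_dedup.2 hi)]

theorem count_rowCopies {l : List α} (hl : ∀ a, a ∈ l) (x : α × α) :
    (rowCopies l).count x = l.count x.2 := by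
  have h := List.count_filter (l := rowCopies l) (p := fun y => decide (y.1 = x.1)) (a := x)
    (by simp)
  rw [← h, filter_rowCopies (hl x.1)]
  exact List.count_map_of_injective l (Prod.mk x.1) (Prod.mk_right_injective _) x.2

theorem count_gridSeq {l : List α} (hl : ∀ a, a ∈ l) (x : α × α) :
    (gridSeq l).count x = l.count x.1 + l.count x.2 := by
  have h := List.count_map_of_injective (rowCopies l) Prod.swap Prod.swap_injective x.swap
  rw [Prod.swap_swap] at h
  rw [gridSeq, List.count_append, h, List.count_reverse, count_rowCopies hl, count_rowCopies hl,
    Prod.snd_swap]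

theorem pairwise_rowCopies (l : List α) :
    (rowCopies l).Pairwise fun x y => l.dedup.idxOf x.1 ≤ l.dedup.idxOf y.1 := by
  rw [rowCopies, List.pairwise_flatMap]
  constructor
  · intro a _
    rw [List.pairwise_map]
    exact List.pairwise_of_forall (by simp)
  · rw [List.pairwise_iff_getElem]
    intro i j hi hj hij x hx y hy
    obtain ⟨_, _, rfl⟩ := List.mem_map.1 hx
    obtain ⟨_, _, rfl⟩ := List.mem_map.1 hy
    simp only [l.nodup_dedup.idxOf_getElem]
    exact hij.le

theorem not_sublist_rowCopies {l : List α} (hl : ∀ a, a ∈ l) {a b : α × α} (hab : a.1 ≠ b.1) :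
    ¬ [a, b, a].Sublist (rowCopies l) := by
  intro h
  have := (pairwise_rowCopies l).sublist h
  simp at this
  exact hab ((List.idxOf_inj (List.mem_dedup.2 (hl _))).1 (le_antisymm this.1 this.2))

theorem reverse_gridSeq (l : List α) : (gridSeq l).reverse = (gridSeq l).map Prod.swap := by
  simp [gridSeq, Function.comp_def]

theorem altSeq_sublist_reverse_of_rowCopies {l : List α} {i j k : α} (hi : i ∈ l) {m : ℕ} :
    (altSeq (i, j) (i, k) m).Sublist (rowCopies l).reverse ↔ (altSeq j k m).Sublist l.reverse := by
  constructor
  · intro h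
    have h' := (h.filter (fun x => decide (x.1 = i))).map Prod.snd
    rw [List.filter_reverse, filter_rowCopies hi, List.filter_eq_self.2, map_altSeq] at h'
    · simpa [Function.comp_def] using h'
    · intro x hx
      rcases mem_altSeq hx with rfl | rfl <;> simp
  · intro h
    have h' := h.map (Prod.mk i)
    rw [map_altSeq, List.map_reverse, ← filter_rowCopies hi, ← List.filter_reverse] at h'
    exact h'.trans List.filter_sublist

theorem not_altSeq_sublist_gridSeq_of_fst_eq {l : List α} (hl : ∀ a, a ∈ l) {k : ℕ} (hk : 2 ≤ k)
    (h : AvoidsAlt l k) {a b : α × α} (hab : a ≠ b) (hrow : a.1 = b.1) :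
    ¬ (altSeq a b (k + 1)).Sublist (gridSeq l) := by
  obtain ⟨i, x⟩ := a
  obtain ⟨i', y⟩ := b
  obtain rfl : i = i' := hrow
  have key : ∀ x y : α, l.dedup.idxOf x < l.dedup.idxOf y →
      ¬ ((altSeq (i, x) (i, y) (k + 1)).Sublist (gridSeq l) ∨
        (altSeq (i, y) (i, x) (k + 1)).Sublist (gridSeq l)) := by
    intro x y hlt hs
    have hxy : x ≠ y := by rintro rfl; exact lt_irrefl _ hlt
    have := altSeq_sublist_of_sublist_append hk ?_ ?_ hs
    · rw [altSeq_sublist_reverse_of_rowCopies (hl i),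
        altSeq_sublist_reverse_of_rowCopies (hl i)] at this
      exact this.elim (h.reverse x y hxy) (h.reverse y x hxy.symm)
    · intro hc
      have := (pairwise_rowCopies l).sublist (by simpa using hc.map Prod.swap)
      simp at this
      omega
    · intro m hm
      rw [altSeq_sublist_reverse_of_rowCopies (hl i)] at hm ⊢
      have := append_sublist_of_idxOf_dedup_lt (u := (altSeq y x m).reverse) (hl y) hlt
        (by simpa [altSeq] using hm.reverse)
      simpa [altSeq] using this.reverse
  have hne : l.dedup.idxOf x ≠ l.dedup.idxOf y := fun e =>
    hab (by rw [(List.idxOf_inj (List.mem_dedup.2 (hl _))).1 e])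
  intro hs
  rcases hne.lt_or_gt with hlt | hlt
  · exact key x y hlt (Or.inl hs)
  · exact key y x hlt (Or.inr hs)

theorem avoidsAlt_gridSeq {l : List α} (hl : ∀ a, a ∈ l) {k : ℕ} (hk : 4 ≤ k)
    (h : AvoidsAlt l k) : AvoidsAlt (gridSeq l) (k + 1) := by
  intro a b hab hs
  by_cases h1 : a.1 = b.1
  · exact not_altSeq_sublist_gridSeq_of_fst_eq hl (by omega) h hab h1 hs
  by_cases h2 : a.2 = b.2
  · have hs' := hs.reverse.map Prod.swap
    rw [reverse_gridSeq, List.map_map, Prod.swap_swap_eq, List.map_id] at hs'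
    rcases reverse_altSeq_eq_or a b (k + 1) with e | e <;> rw [e, map_altSeq] at hs'
    · exact not_altSeq_sublist_gridSeq_of_fst_eq hl (by omega) h (Prod.swap_injective.ne hab) h2 hs'
    · exact not_altSeq_sublist_gridSeq_of_fst_eq hl (by omega) h (Prod.swap_injective.ne hab.symm)
        h2.symm hs'
  refine not_altSeq_five_sublist_append ?_ ?_ ?_
    ((altSeq_isPrefix_of_le a b (by omega : 5 ≤ k + 1)).sublist.trans hs)
  · intro hc
    exact not_sublist_rowCopies hl (a := a.swap) (b := b.swap) h2 (by simpa using hc.map Prod.swap)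
  · intro hc
    exact not_sublist_rowCopies hl h1 (by simpa using hc.reverse)
  · intro hc
    exact not_sublist_rowCopies hl (Ne.symm h1) (by simpa using hc.reverse)

end Grid

theorem stmt2 (s n μ : ℕ) (hs : 1 ≤ s) (hn : 1 ≤ n) (hμ : 1 ≤ μ)
    (h : ∃ l : List (Fin n), (∀ a : Fin n, l.count a = μ) ∧ AvoidsAlt l (s + 2)) :
    ∃ l : List (Fin (n ^ 2)),
      (∀ a : Fin (n ^ 2), l.count a = 2 * μ) ∧ AvoidsAlt l (max 3 (s + 1) + 2) := by
  obtain ⟨l, hcount, havoid⟩ := h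
  have hl : ∀ a, a ∈ l := fun a => List.count_pos_iff.1 (by rw [hcount]; omega)
  let e : Fin n × Fin n ≃ Fin (n ^ 2) := finProdFinEquiv.trans (finCongr (sq n).symm)
  refine ⟨(gridSeq l).map e, fun a => ?_, ?_⟩
  · have hc := List.count_map_of_injective (gridSeq l) e e.injective (e.symm a)
    rw [e.apply_symm_apply] at hc
    rw [hc, count_gridSeq hl, hcount, hcount, two_mul]
  · exact (avoidsAlt_gridSeq hl (k := max 3 (s + 1) + 1) (by omega)
      (havoid.mono (by omega))).map e
end

section
/- For every integer t ≥ 2 there exist constants c, C > 0 such that for all sufficiently large integers n, c · n^(1+1/t) ≤ z(⌈n^(2/t)⌉, n; t, 2) ≤ C · n^(1+1/t). -/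
def Ones {m n : ℕ} (M : Fin m → Fin n → Bool) : ℕ :=
  (Finset.univ.filter fun p : Fin m × Fin n => M p.1 p.2 = true).card

/-- `M` avoids `s × t` all-1 submatrices: there are no `s` rows and `t` columns
all of whose `s * t` intersection entries equal 1. -/
def AvoidsAllOnes {m n : ℕ} (M : Fin m → Fin n → Bool) (s t : ℕ) : Prop :=
  ¬ ∃ (R : Finset (Fin m)) (C : Finset (Fin n)),
      R.card = s ∧ C.card = t ∧ ∀ i ∈ R, ∀ j ∈ C, M i j = true

/-- `zar m n s t` is the maximum number of 1-entries in an `m × n` 0-1 matrix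
avoiding `s × t` all-1 submatrices. -/
noncomputable def zar (m n s t : ℕ) : ℕ :=
  sSup { k | ∃ M : Fin m → Fin n → Bool, AvoidsAllOnes M s t ∧ Ones M = k }

theorem Ones.le_mul {m n : ℕ} (M : Fin m → Fin n → Bool) : Ones M ≤ m * n := by
  unfold Ones
  exact (Finset.card_le_univ _).trans (by simp)

theorem Ones.le_zar {m n s t : ℕ} {M : Fin m → Fin n → Bool} (hM : AvoidsAllOnes M s t) :
    Ones M ≤ zar m n s t := by
  refine le_csSup ⟨m * n, ?_⟩ ⟨M, hM, rfl⟩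
  rintro k ⟨M', -, rfl⟩
  exact Ones.le_mul M'

/-- Two distinct columns of a matrix avoiding `t × 2` all-1 submatrices share fewer than `t` ones. -/
theorem AvoidsAllOnes.card_common_lt {m n t : ℕ} {M : Fin m → Fin n → Bool}
    (hM : AvoidsAllOnes M t 2) {j k : Fin n} (hjk : j ≠ k) :
    (Finset.univ.filter fun i => M i j = true ∧ M i k = true).card < t := by
  by_contra! h
  obtain ⟨R, hR, hRt⟩ := Finset.exists_subset_card_eq h
  refine hM ⟨R, {j, k}, hRt, Finset.card_pair hjk, fun i hi l hl => ?_⟩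
  have hi' := (Finset.mem_filter.mp (hR hi)).2
  rcases Finset.mem_insert.mp hl with rfl | hl
  · exact hi'.1
  · rw [Finset.mem_singleton.mp hl]
    exact hi'.2

theorem Ones.eq_sum {m n : ℕ} (M : Fin m → Fin n → Bool) :
    Ones M = ∑ i, ∑ j, if M i j = true then 1 else 0 := by
  rw [Ones, Finset.card_filter, Fintype.sum_prod_type]

/-- The Kővári–Sós–Turán double count for `t × 2` all-1 submatrices. -/
theorem AvoidsAllOnes.ones_sq_le {m n t : ℕ} {M : Fin m → Fin n → Bool}
    (hM : AvoidsAllOnes M t 2) : Ones M ^ 2 ≤ m * (Ones M + n ^ 2 * t) := by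
  have hcs : Ones M ^ 2 ≤ m * ∑ i, (∑ j, if M i j = true then 1 else 0) ^ 2 := by
    rw [Ones.eq_sum]
    simpa using sq_sum_le_card_mul_sum_sq (s := (Finset.univ : Finset (Fin m)))
      (f := fun i => ∑ j, if M i j = true then (1 : ℕ) else 0)
  refine hcs.trans (Nat.mul_le_mul_left _ ?_)
  have hswap : ∑ i, (∑ j, if M i j = true then 1 else 0) ^ 2 =
      ∑ j, ∑ k, (Finset.univ.filter fun i => M i j = true ∧ M i k = true).card := by
    simp_rw [sq, Finset.sum_mul_sum, Finset.card_filter]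
    rw [Finset.sum_comm]
    refine Finset.sum_congr rfl fun j _ => ?_
    rw [Finset.sum_comm]
    refine Finset.sum_congr rfl fun k _ => Finset.sum_congr rfl fun i _ => ?_
    by_cases h : M i j = true <;> by_cases h' : M i k = true <;> simp [h, h']
  rw [hswap]
  calc _ ≤ ∑ j : Fin n, ∑ k : Fin n,
        ((if j = k then ∑ i, (if M i j = true then 1 else 0) else 0) + t) := by
        refine Finset.sum_le_sum fun j _ => Finset.sum_le_sum fun k _ => ?_
        split_ifs with h
        · subst h
          simp
        · simpa using (hM.card_common_lt h).le
    _ = Ones M + n ^ 2 * t := by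
        rw [Ones.eq_sum, Finset.sum_comm (s := (Finset.univ : Finset (Fin m)))]
        simp [Finset.sum_add_distrib]
        ring

/-- Incidences of points of `F × F` with graphs of polynomials of degree less than `t`. -/
theorem pow_succ_le_zar {m n t : ℕ} (F : Type) [Field F] [Fintype F] (ht : 0 < t)
    (hm : Fintype.card F ^ 2 ≤ m) (hn : Fintype.card F ^ t ≤ n) :
    Fintype.card F ^ (t + 1) ≤ zar m n t 2 := by
  classical
  let E := Polynomial.degreeLTEquiv F t
  obtain ⟨e⟩ : Nonempty (F × F ↪ Fin m) :=
    Function.Embedding.nonempty_of_card_le (by simpa [sq] using hm)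
  obtain ⟨f⟩ : Nonempty ((Fin t → F) ↪ Fin n) :=
    Function.Embedding.nonempty_of_card_le (by simpa using hn)
  let g : (Fin t → F) → F → F := fun c a => ((E.symm c : Polynomial.degreeLT F t) :
    Polynomial F).eval a
  let M : Fin m → Fin n → Bool := fun i j => decide (∃ a c, e (a, g c a) = i ∧ f c = j)
  have hM : AvoidsAllOnes M t 2 := by
    rintro ⟨R, C, hR, hC, h⟩
    obtain ⟨j, k, hjk, rfl⟩ := Finset.card_eq_two.mp hC
    have hj : ∀ i ∈ R, ∃ a c, e (a, g c a) = i ∧ f c = j := fun i hi => by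
      simpa [M] using h i hi j (by simp)
    have hk : ∀ i ∈ R, ∃ a c, e (a, g c a) = i ∧ f c = k := fun i hi => by
      simpa [M] using h i hi k (by simp)
    obtain ⟨i₀, hi₀⟩ : R.Nonempty := Finset.card_pos.mp (hR ▸ ht)
    obtain ⟨-, c, -, rfl⟩ := hj i₀ hi₀
    obtain ⟨-, d, -, rfl⟩ := hk i₀ hi₀
    have hcommon : ∀ i : R, ∃ a, e (a, g c a) = i ∧ g c a = g d a := by
      rintro ⟨i, hi⟩
      obtain ⟨a, c', ha, hc⟩ := hj i hi
      obtain ⟨b, d', hb, hd⟩ := hk i hi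
      obtain rfl := f.injective hc
      obtain rfl := f.injective hd
      obtain ⟨hab, hg⟩ := Prod.mk.inj (e.injective (ha.trans hb.symm))
      subst hab
      exact ⟨a, ha, hg⟩
    choose α hα hα' using hcommon
    have hinj : Function.Injective α := fun x y hxy => by
      apply Subtype.ext
      rw [← hα x, ← hα y, hxy]
    have hcard : (Finset.univ.image α).card = t := by
      rw [Finset.card_image_of_injective _ hinj, Finset.card_univ, Fintype.card_coe, hR]
    refine hjk (congrArg f (E.symm.injective (Subtype.ext ?_)))
    refine Polynomial.eq_of_degree_sub_lt_of_eval_finset_eq (Finset.univ.image α) ?_ ?_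
    · rw [hcard]
      exact Polynomial.mem_degreeLT.mp (Submodule.sub_mem _ (E.symm c).2 (E.symm d).2)
    · intro x hx
      obtain ⟨i, -, rfl⟩ := Finset.mem_image.mp hx
      exact hα' i
  refine le_trans ?_ (Ones.le_zar hM)
  have hcount := Finset.card_le_card_of_injOn
    (s := (Finset.univ : Finset (F × (Fin t → F))))
    (t := Finset.univ.filter fun p : Fin m × Fin n => M p.1 p.2 = true)
    (fun x => (e (x.1, g x.2 x.1), f x.2))
    (fun x _ => by
      simp only [Finset.coe_filter, Finset.mem_univ, true_and, Set.mem_ofPred_eq, M,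
        decide_eq_true_eq]
      exact ⟨x.1, x.2, rfl, rfl⟩)
    (fun x _ y _ hxy => by
      obtain ⟨h₁, h₂⟩ := Prod.mk.inj hxy
      exact Prod.ext (Prod.mk.inj (e.injective h₁)).1 (f.injective h₂))
  simpa [Ones, pow_succ, mul_comm] using hcount

theorem stmt6 (t : ℕ) (ht : 2 ≤ t) :
    ∃ c C : ℝ, 0 < c ∧ 0 < C ∧ ∃ N : ℕ, ∀ n : ℕ, N ≤ n →
      c * (n : ℝ) ^ ((1 : ℝ) + 1 / t) ≤ (zar ⌈(n : ℝ) ^ ((2 : ℝ) / t)⌉₊ n t 2 : ℝ) ∧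
      (zar ⌈(n : ℝ) ^ ((2 : ℝ) / t)⌉₊ n t 2 : ℝ) ≤ C * (n : ℝ) ^ ((1 : ℝ) + 1 / t) := by
  refine ⟨(1 / 2) ^ (t + 1), 2 + 2 * t, by positivity, by positivity, 2 ^ t, fun n hn => ?_⟩
  have ht0 : t ≠ 0 := by omega
  have hn1 : (1 : ℝ) ≤ n := by exact_mod_cast Nat.one_le_two_pow.trans hn
  obtain ⟨x, hx⟩ : ∃ x : ℝ, x = (n : ℝ) ^ ((1 : ℝ) / t) := ⟨_, rfl⟩
  have hxt : x ^ t = n := by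
    rw [hx, one_div, Real.rpow_inv_natCast_pow (by positivity) ht0]
  have hx0 : 0 ≤ x := hx ▸ by positivity
  have hx2 : 2 ≤ x := by
    refine le_of_pow_le_pow_left₀ ht0 hx0 ?_
    rw [hxt]
    exact_mod_cast hn
  have hxn : x ≤ n := hxt ▸ le_self_pow₀ (by linarith) ht0
  have hrows : (n : ℝ) ^ ((2 : ℝ) / t) = x ^ 2 := by
    rw [hx, ← Real.rpow_natCast, ← Real.rpow_mul (by positivity)]
    congr 1
    push_cast
    ring
  have hones : (n : ℝ) ^ ((1 : ℝ) + 1 / t) = n * x := by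
    rw [Real.rpow_add (by linarith), Real.rpow_one, hx]
  rw [hrows, hones]
  constructor
  · have hk : ⌊x / 2⌋₊ ≠ 0 := (Nat.floor_pos.mpr (by linarith)).ne'
    obtain ⟨p, hp, hkp, hpk⟩ := Nat.exists_prime_lt_and_le_two_mul _ hk
    have : Fact p.Prime := ⟨hp⟩
    have hpx : (p : ℝ) ≤ x := by
      have h₁ : (p : ℝ) ≤ 2 * ⌊x / 2⌋₊ := by exact_mod_cast hpk
      have h₂ := Nat.floor_le (by positivity : 0 ≤ x / 2)
      linarith
    have hxp : x / 2 ≤ p := (Nat.lt_of_floor_lt hkp).le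
    have hz : p ^ (t + 1) ≤ zar ⌈x ^ 2⌉₊ n t 2 := by
      have := pow_succ_le_zar (m := ⌈x ^ 2⌉₊) (n := n) (t := t) (ZMod p) (by omega)
      rw [ZMod.card] at this
      refine this ?_ ?_
      · have h : ((p ^ 2 : ℕ) : ℝ) ≤ ⌈x ^ 2⌉₊ := by
          push_cast
          exact (pow_le_pow_left₀ (by positivity) hpx 2).trans (Nat.le_ceil _)
        exact_mod_cast h
      · have h : (p : ℝ) ^ t ≤ n := hxt ▸ pow_le_pow_left₀ (by positivity) hpx t
        exact_mod_cast h
    calc (1 / 2 : ℝ) ^ (t + 1) * (n * x) = (x / 2) ^ (t + 1) := by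
          rw [← hxt, ← pow_succ, ← mul_pow]
          ring
      _ ≤ (p : ℝ) ^ (t + 1) := pow_le_pow_left₀ (by positivity) hxp _
      _ ≤ _ := by exact_mod_cast hz
  · have hy : 0 < n * x := by positivity
    refine (Nat.le_floor_iff (by positivity)).mp (csSup_le' ?_)
    rintro k ⟨M, hM, rfl⟩
    refine (Nat.le_floor_iff (by positivity)).mpr ?_
    have hsq : (Ones M : ℝ) ^ 2 ≤ ⌈x ^ 2⌉₊ * (Ones M + n ^ 2 * t) := by
      exact_mod_cast hM.ones_sq_le
    have hceil : (⌈x ^ 2⌉₊ : ℝ) ≤ 2 * x ^ 2 := by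
      have := Nat.ceil_lt_add_one (by positivity : 0 ≤ x ^ 2)
      nlinarith
    have hxy : x ^ 2 ≤ n * x := by nlinarith
    generalize (Ones M : ℝ) = z at *
    by_contra! hlt
    have ht' : (2 : ℝ) ≤ t := by exact_mod_cast ht
    have hz : n * x < z := by nlinarith
    have hz0 : 0 < z := hy.trans hz
    have hbound : z ^ 2 ≤ 2 * (n * x) * z + 2 * t * (n * x) * (n * x) := by
      calc z ^ 2 ≤ 2 * x ^ 2 * (z + n ^ 2 * t) :=
            hsq.trans (mul_le_mul_of_nonneg_right hceil (by positivity))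
        _ = 2 * x ^ 2 * z + 2 * t * (n * x) * (n * x) := by ring
        _ ≤ _ := by gcongr
    have h₁ : (2 + 2 * t) * (n * x) * z < z * z := by gcongr
    have h₂ : 2 * t * (n * x) * (n * x) ≤ 2 * t * (n * x) * z := by gcongr
    linarith
end
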